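/- There is no ℝ-linear map Q : P_{≤4} → End_ℂ(ℂ[x]) such that Q(1) = id, Q(q) = q̂, Q(p) = p̂, and [Q(f), Q(g)] = iℏ·Q({f,g}) for all f, g ∈ P_{≤3} (note that {f,g} has total degree ≤ 4 whenever f, g ∈ P_{≤3}, so Q may be applied to it). -/

import Mathlib

open MvPolynomial

/-- The canonical Poisson bracket on `ℝ[q,p]` with `q = X 0`, `p = X 1`:
`{f,g} = (∂f/∂q)(∂g/∂p) − (∂f/∂p)(∂g/∂q)`. -/
noncomputable def poissonBracket (f g : MvPolynomial (Fin 2) ℝ) : MvPolynomial (Fin 2) ℝ :=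
  pderiv 0 f * pderiv 1 g - pderiv 1 f * pderiv 0 g

/-- The position operator `q̂` on `ℂ[x]`: multiplication by `x`. -/
noncomputable def qhat : Polynomial ℂ →ₗ[ℂ] Polynomial ℂ where
  toFun f := Polynomial.X * f
  map_add' a b := by ring
  map_smul' c f := by simp [mul_smul_comm]

/-- The momentum operator `p̂ = -iℏ d/dx` on `ℂ[x]`. -/
noncomputable def phat (ℏ : ℝ) : Polynomial ℂ →ₗ[ℂ] Polynomial ℂ :=
  (-(Complex.I * (ℏ : ℂ))) • (Polynomial.derivative : Polynomial ℂ →ₗ[ℂ] Polynomial ℂ)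

set_option linter.unusedSimpArgs false

lemma gC2 : (C (2 : ℝ) : MvPolynomial (Fin 2) ℝ) = 2 := map_ofNat C 2

lemma gC3 : (C (3 : ℝ) : MvPolynomial (Fin 2) ℝ) = 3 := map_ofNat C 3

lemma gC4 : (C (4 : ℝ) : MvPolynomial (Fin 2) ℝ) = 4 := map_ofNat C 4

lemma gC6 : (C (6 : ℝ) : MvPolynomial (Fin 2) ℝ) = 6 := map_ofNat C 6

lemma gC9 : (C (9 : ℝ) : MvPolynomial (Fin 2) ℝ) = 9 := map_ofNat C 9

noncomputable def gmon (i j : ℕ) : MvPolynomial (Fin 2) ℝ := X 0 ^ i * X 1 ^ j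

lemma gmon_deg (i j n : ℕ) (h : i + j ≤ n) : gmon i j ∈ restrictTotalDegree (Fin 2) ℝ n := by
  rw [mem_restrictTotalDegree]
  refine (totalDegree_mul _ _).trans ?_
  refine (add_le_add (totalDegree_pow _ _) (totalDegree_pow _ _)).trans ?_
  simpa [totalDegree_X] using h

lemma schur_weyl (T : Module.End ℂ (Polynomial ℂ)) (ℏ : ℝ) (hℏ : ℏ ≠ 0)
    (h1 : T * qhat = qhat * T) (h2 : T * phat ℏ = phat ℏ * T) :
    ∃ c : ℂ, T = c • (1 : Module.End ℂ (Polynomial ℂ)) := by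
  have hX : ∀ f, T (Polynomial.X * f) = Polynomial.X * T f := fun f => LinearMap.congr_fun h1 f
  have hD : Polynomial.derivative (T 1) = 0 := by
    have := LinearMap.congr_fun h2 1
    simpa [phat, hℏ] using this.symm
  have hn : ∀ n : ℕ, T (Polynomial.X ^ n) = Polynomial.X ^ n * T 1 := by
    intro n
    induction n with
    | zero => simp
    | succ n ih => rw [pow_succ', hX, ih, mul_assoc]
  refine ⟨(T 1).coeff 0, ?_⟩
  have hc := Polynomial.eq_C_of_derivative_eq_zero hD
  apply Polynomial.lhom_ext'
  intro n
  ext1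
  simp only [LinearMap.comp_apply, Polynomial.monomial_one_right_eq_X_pow, hn]
  rw [hc, LinearMap.smul_apply, Module.End.one_apply, Polynomial.smul_eq_C_mul, mul_comm,
    Polynomial.coeff_C_zero]

theorem groenewold_aux (ℏ : ℝ) (hℏ : ℏ ≠ 0) (F : ℕ → ℕ → Module.End ℂ (Polynomial ℂ))
    (h10 : F 1 0 = qhat) (h01 : F 0 1 = phat ℏ)
    (H : ∀ i j k l a b : ℕ, ∀ r : ℝ, i + j ≤ 3 → k + l ≤ 3 → a + b ≤ 4 →
      poissonBracket (gmon i j) (gmon k l) = r • gmon a b →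
      F i j * F k l - F k l * F i j = (Complex.I * ℏ * r) • F a b) : False := by
  obtain ⟨h, hh⟩ : ∃ h : ℂ, h = Complex.I * ℏ := ⟨_, rfl⟩
  have hne : h ≠ 0 := by simp [hh, hℏ]
  rw [← hh] at H
  have e1 := H 2 0 1 0 0 0 0 (by norm_num) (by norm_num) (by norm_num)
    (by simp [poissonBracket, gmon])
  have e2 := H 2 0 0 1 1 0 2 (by norm_num) (by norm_num) (by norm_num)
    (by simp [poissonBracket, gmon, smul_eq_C_mul, pderiv_X, gC2, gC3, gC4, gC6, gC9])
  have e3 := H 0 2 1 0 0 1 (-2) (by norm_num) (by norm_num) (by norm_num)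
    (by simp [poissonBracket, gmon, smul_eq_C_mul, pderiv_X, gC2, gC3, gC4, gC6, gC9])
  have e4 := H 0 2 0 1 0 0 0 (by norm_num) (by norm_num) (by norm_num)
    (by simp [poissonBracket, gmon])
  have e5 := H 2 0 0 2 1 1 4 (by norm_num) (by norm_num) (by norm_num)
    (by simp [poissonBracket, gmon, smul_eq_C_mul, pderiv_X, gC2, gC3, gC4, gC6, gC9]; ring)
  have e6 := H 2 0 1 1 2 0 2 (by norm_num) (by norm_num) (by norm_num)
    (by simp [poissonBracket, gmon, smul_eq_C_mul, pderiv_X, gC2, gC3, gC4, gC6, gC9]; ring)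
  have e7 := H 1 1 0 2 0 2 2 (by norm_num) (by norm_num) (by norm_num)
    (by simp [poissonBracket, gmon, smul_eq_C_mul, pderiv_X, gC2, gC3, gC4, gC6, gC9]; ring)
  have e8 := H 3 0 1 0 0 0 0 (by norm_num) (by norm_num) (by norm_num)
    (by simp [poissonBracket, gmon])
  have e9 := H 3 0 0 1 2 0 3 (by norm_num) (by norm_num) (by norm_num)
    (by simp [poissonBracket, gmon, smul_eq_C_mul, pderiv_X, gC2, gC3, gC4, gC6, gC9])
  have e10 := H 0 3 1 0 0 2 (-3) (by norm_num) (by norm_num) (by norm_num)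
    (by simp [poissonBracket, gmon, smul_eq_C_mul, pderiv_X, gC2, gC3, gC4, gC6, gC9])
  have e11 := H 0 3 0 1 0 0 0 (by norm_num) (by norm_num) (by norm_num)
    (by simp [poissonBracket, gmon])
  have e12 := H 3 0 0 2 2 1 6 (by norm_num) (by norm_num) (by norm_num)
    (by simp [poissonBracket, gmon, smul_eq_C_mul, pderiv_X, gC2, gC3, gC4, gC6, gC9]; ring)
  have e13 := H 2 0 0 3 1 2 6 (by norm_num) (by norm_num) (by norm_num)
    (by simp [poissonBracket, gmon, smul_eq_C_mul, pderiv_X, gC2, gC3, gC4, gC6, gC9]; ring)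
  have e14 := H 3 0 0 3 2 2 9 (by norm_num) (by norm_num) (by norm_num)
    (by simp [poissonBracket, gmon, smul_eq_C_mul, pderiv_X, gC2, gC3, gC4, gC6, gC9]; ring)
  have e15 := H 2 1 1 2 2 2 3 (by norm_num) (by norm_num) (by norm_num)
    (by simp [poissonBracket, gmon, smul_eq_C_mul, pderiv_X, gC2, gC3, gC4, gC6, gC9]; ring)
  clear H
  push_cast at *
  rw [h10] at *
  rw [h01] at *
  have hq : ∀ f, qhat f = Polynomial.X * f := fun f => rfl
  have hp : ∀ f, phat ℏ f = -(Polynomial.C h * Polynomial.derivative f) := fun f => by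
    simp [phat, hh, Polynomial.smul_eq_C_mul]
  have h2 : (Polynomial.C (2 : ℂ) : Polynomial ℂ) = 2 := map_ofNat Polynomial.C 2
  have h3 : (Polynomial.C (3 : ℂ) : Polynomial ℂ) = 3 := map_ofNat Polynomial.C 3
  have h4 : (Polynomial.C (4 : ℂ) : Polynomial ℂ) = 4 := map_ofNat Polynomial.C 4
  have h6 : (Polynomial.C (6 : ℂ) : Polynomial ℂ) = 6 := map_ofNat Polynomial.C 6
  have h9 : (Polynomial.C (9 : ℂ) : Polynomial ℂ) = 9 := map_ofNat Polynomial.C 9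
  have comm : qhat * phat ℏ = phat ℏ * qhat + h • (1 : Module.End ℂ (Polynomial ℂ)) := by
    refine LinearMap.ext fun f => ?_
    simp [hq, hp, Polynomial.smul_eq_C_mul]
    ring
  obtain ⟨c, hc⟩ := schur_weyl (F 2 0 - qhat ^ 2) ℏ hℏ (by
    refine LinearMap.ext fun f => ?_
    have := LinearMap.congr_fun e1 f
    simp [hq, hp, Polynomial.smul_eq_C_mul, pow_two, h2] at this ⊢
    linear_combination this) (by
    refine LinearMap.ext fun f => ?_
    have := LinearMap.congr_fun e2 f
    simp [hq, hp, Polynomial.smul_eq_C_mul, pow_two, h2] at this ⊢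
    linear_combination this)
  obtain ⟨d, hd⟩ := schur_weyl (F 0 2 - phat ℏ ^ 2) ℏ hℏ (by
    refine LinearMap.ext fun f => ?_
    have := LinearMap.congr_fun e3 f
    simp [hq, hp, Polynomial.smul_eq_C_mul, pow_two, h2] at this ⊢
    linear_combination this) (by
    refine LinearMap.ext fun f => ?_
    have := LinearMap.congr_fun e4 f
    simp [hq, hp, Polynomial.smul_eq_C_mul, pow_two, h2] at this ⊢
    linear_combination this)
  have f20 : ∀ f, F 2 0 f = Polynomial.X ^ 2 * f + Polynomial.C c * f := fun f => by
    have := LinearMap.congr_fun hc f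
    simp [hq, hp, Polynomial.smul_eq_C_mul, pow_two, h2] at this ⊢
    linear_combination this
  have f02 : ∀ f, F 0 2 f = Polynomial.C h ^ 2 * Polynomial.derivative (Polynomial.derivative f)
      + Polynomial.C d * f := fun f => by
    have := LinearMap.congr_fun hd f
    simp [hq, hp, Polynomial.smul_eq_C_mul, pow_two] at this ⊢
    linear_combination this
  have hC : (Polynomial.C h : Polynomial ℂ) ≠ 0 := by simpa using hne
  have f11 : ∀ f, 2 * F 1 1 f = - Polynomial.C h * (2 * Polynomial.X * Polynomial.derivative f + f) :=
      fun f => by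
    have := LinearMap.congr_fun e5 f
    simp [f20, f02, Polynomial.smul_eq_C_mul, pow_two] at this ⊢
    have h2C : (2 * Polynomial.C h : Polynomial ℂ) ≠ 0 := mul_ne_zero two_ne_zero hC
    apply mul_left_cancel₀ h2C
    linear_combination -this - Polynomial.C h * F 1 1 f * h4
  have hc0 : c = 0 := by
    have := LinearMap.congr_fun e6 1
    have a1 := f11 1
    have a2 := f11 (F 2 0 1)
    simp [f20, Polynomial.smul_eq_C_mul] at this a1 a2
    have : (4 * Polynomial.C h) * Polynomial.C c = 0 := by
      linear_combination (-2) * this + (Polynomial.X ^ 2 + Polynomial.C c) * a1 - a2 - 2 * Polynomial.C h * (Polynomial.X ^ 2 + Polynomial.C c) * h2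
    simpa [hne] using this
  have hd0 : d = 0 := by
    have := LinearMap.congr_fun e7 1
    have a1 := f11 1
    have a2 := f11 (F 0 2 1)
    simp [f02, Polynomial.smul_eq_C_mul] at this a1 a2
    have a4 : F 1 1 1 = Polynomial.C (-h / 2) := by
      apply mul_left_cancel₀ (two_ne_zero : (2 : Polynomial ℂ) ≠ 0)
      rw [a1, ← h2, ← Polynomial.C_mul, ← Polynomial.C_neg]
      congr 1
      ring
    have a3 : Polynomial.derivative (F 1 1 1) = 0 := by rw [a4, Polynomial.derivative_C]
    have : (4 * Polynomial.C h) * Polynomial.C d = 0 := by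
      rw [a3, Polynomial.derivative_zero] at this
      linear_combination (-2) * this - Polynomial.C d * a1 + a2 - 2 * Polynomial.C h * (Polynomial.C d) * h2
    simpa [hne] using this
  subst hc0 hd0
  simp only [map_zero, zero_mul, add_zero] at f20 f02
  obtain ⟨a, ha⟩ := schur_weyl (F 3 0 - qhat ^ 3) ℏ hℏ (by
    refine LinearMap.ext fun f => ?_
    have := LinearMap.congr_fun e8 f
    simp [hq, hp, Polynomial.smul_eq_C_mul, pow_succ] at this ⊢
    linear_combination this) (by
    refine LinearMap.ext fun f => ?_
    have := LinearMap.congr_fun e9 f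
    simp [hq, hp, f20, Polynomial.smul_eq_C_mul, pow_succ, h3] at this ⊢
    linear_combination this)
  obtain ⟨b, hb⟩ := schur_weyl (F 0 3 - phat ℏ ^ 3) ℏ hℏ (by
    refine LinearMap.ext fun f => ?_
    have := LinearMap.congr_fun e10 f
    simp [hq, hp, f02, Polynomial.smul_eq_C_mul, pow_succ, h3] at this ⊢
    linear_combination this) (by
    refine LinearMap.ext fun f => ?_
    have := LinearMap.congr_fun e11 f
    simp [hq, hp, Polynomial.smul_eq_C_mul, pow_succ] at this ⊢
    linear_combination this)
  have f30 : ∀ f, F 3 0 f = Polynomial.X ^ 3 * f + Polynomial.C a * f := fun f => by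
    have := LinearMap.congr_fun ha f
    simp [hq, hp, Polynomial.smul_eq_C_mul, pow_succ] at this ⊢
    linear_combination this
  have f03 : ∀ f, F 0 3 f = -Polynomial.C h ^ 3 * Polynomial.derivative (Polynomial.derivative
      (Polynomial.derivative f)) + Polynomial.C b * f := fun f => by
    have := LinearMap.congr_fun hb f
    simp [hq, hp, Polynomial.smul_eq_C_mul, pow_succ] at this ⊢
    linear_combination this
  have f21 : F 2 1 1 = -Polynomial.C h * Polynomial.X := by
    have := LinearMap.congr_fun e12 1
    simp [f30, f02, Polynomial.smul_eq_C_mul, h6, h2] at this ⊢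
    apply mul_left_cancel₀ (mul_ne_zero hC (by norm_num : (6 : Polynomial ℂ) ≠ 0))
    linear_combination -this
  have f12 : F 1 2 1 = 0 := by
    have := LinearMap.congr_fun e13 1
    simpa [f20, f03, Polynomial.smul_eq_C_mul, h6, h2, hne] using this
  have f12X : F 1 2 Polynomial.X = Polynomial.C h ^ 2 := by
    have := LinearMap.congr_fun e13 Polynomial.X
    simp [f20, f03, Polynomial.smul_eq_C_mul, h6, h2] at this ⊢
    apply mul_left_cancel₀ (mul_ne_zero hC (by norm_num : (6 : Polynomial ℂ) ≠ 0))
    linear_combination -this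
  have g1 := LinearMap.congr_fun e14 1
  have g2 := LinearMap.congr_fun e15 1
  have hl : F 1 2 (-Polynomial.C h * Polynomial.X) = -Polynomial.C h * F 1 2 Polynomial.X := by
    rw [← Polynomial.C_neg, ← Polynomial.smul_eq_C_mul, map_smul, Polynomial.smul_eq_C_mul]
  simp only [LinearMap.sub_apply, Module.End.mul_apply, f21, f12, hl, f12X] at g2
  simp [f30, f03, Polynomial.smul_eq_C_mul, h2, h3, h9] at g1 g2
  have : 3 * Polynomial.C h ^ 3 = 0 := by
    linear_combination g1 - 3 * g2
  simp [hne] at this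

/-- Groenewold's no-go theorem: for `ℏ ≠ 0` there is no ℝ-linear map
`Q : P_{≤4} → End_ℂ(ℂ[x])` with `Q(1) = id`, `Q(q) = q̂`, `Q(p) = p̂`, and
`[Q(f), Q(g)] = iℏ·Q({f,g})` for all `f, g ∈ P_{≤3}`. -/
theorem groenewold_no_go (ℏ : ℝ) (hℏ : ℏ ≠ 0) :
    ¬ ∃ Q : (restrictTotalDegree (Fin 2) ℝ 4) →ₗ[ℝ] (Polynomial ℂ →ₗ[ℂ] Polynomial ℂ),
        Q ⟨1, by simp [mem_restrictTotalDegree]⟩ = LinearMap.id ∧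
        Q ⟨X 0, by simp [mem_restrictTotalDegree, totalDegree_X]⟩ = qhat ∧
        Q ⟨X 1, by simp [mem_restrictTotalDegree, totalDegree_X]⟩ = phat ℏ ∧
        ∀ (f g : MvPolynomial (Fin 2) ℝ)
          (hf : f ∈ restrictTotalDegree (Fin 2) ℝ 3)
          (hg : g ∈ restrictTotalDegree (Fin 2) ℝ 3)
          (hfg : poissonBracket f g ∈ restrictTotalDegree (Fin 2) ℝ 4),
          Q ⟨f, by rw [mem_restrictTotalDegree] at hf ⊢; omega⟩ ∘ₗ
              Q ⟨g, by rw [mem_restrictTotalDegree] at hg ⊢; omega⟩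
            - Q ⟨g, by rw [mem_restrictTotalDegree] at hg ⊢; omega⟩ ∘ₗ
              Q ⟨f, by rw [mem_restrictTotalDegree] at hf ⊢; omega⟩
            = (Complex.I * (ℏ : ℂ)) • Q ⟨poissonBracket f g, hfg⟩ := by
  rintro ⟨Q, -, hq, hp, H⟩
  obtain ⟨G, hG⟩ := LinearMap.exists_extend Q
  have hG' : ∀ f hf, Q ⟨f, hf⟩ = G f := fun f hf => by rw [← hG]; rfl
  simp only [hG'] at hq hp H
  refine groenewold_aux ℏ hℏ (fun i j => G (gmon i j)) (by simpa [gmon] using hq)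
    (by simpa [gmon] using hp) ?_
  intro i j k l a b r h1 h2 h3 h4
  have := H _ _ (gmon_deg i j 3 h1) (gmon_deg k l 3 h2)
    (by rw [h4]; exact Submodule.smul_mem _ _ (gmon_deg a b 4 h3))
  rw [h4, map_smul] at this
  refine Eq.trans this ?_
  rw [mul_smul _ (r : ℂ), Complex.coe_smul]
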